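/- arXiv:1704.03206 — 8 statements merged into one kernel-verified Lean document; each statement's English description precedes it below -/
import Mathlib

section
/- Assume (A0). Then for every real number s ≥ 0 the matrix pencil sE + A of the full order model is regular; concretely, for every s ≥ 0 and every right-hand side (f1, f2, f3) ∈ ℝ^{k1} × ℝ^{k2} × ℝ^{k3} there exists a unique triple (x1, x2, x3) ∈ ℝ^{k1} × ℝ^{k2} × ℝ^{k3} satisfying s·M1·x1 + G·x2 = f1, s·M2·x2 − Gᵀ·x1 + D·x2 − Nᵀ·x3 = f2 and N·x2 = f3. In particular (s = 0) the system matrix A with blocks [[0, G, 0], [−Gᵀ, D, −Nᵀ], [0, N, 0]] is invertible. -/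
open Matrix

/-- The linear map `(x₁, x₂, x₃) ↦ (s M₁ x₁ + G x₂, s M₂ x₂ - Gᵀ x₁ + D x₂ - Nᵀ x₃, N x₂)`
given by the block matrix `s E + A`. -/
def pencilMap {m n p : Type*} [Fintype m] [Fintype n] [Fintype p]
    (M1 : Matrix m m ℝ) (M2 D : Matrix n n ℝ) (G : Matrix m n ℝ) (N : Matrix p n ℝ) (s : ℝ) :
    (m → ℝ) × (n → ℝ) × (p → ℝ) →ₗ[ℝ] (m → ℝ) × (n → ℝ) × (p → ℝ) where
  toFun x := (s • M1.mulVec x.1 + G.mulVec x.2.1,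
    s • M2.mulVec x.2.1 - Gᵀ.mulVec x.1 + D.mulVec x.2.1 - Nᵀ.mulVec x.2.2,
    N.mulVec x.2.1)
  map_add' x y := by
    simp only [Prod.fst_add, Prod.snd_add, mulVec_add, smul_add, Prod.mk_add_mk]
    refine Prod.ext ?_ (Prod.ext ?_ rfl) <;> dsimp only <;> abel
  map_smul' c x := by
    simp only [Prod.smul_fst, Prod.smul_snd, mulVec_smul, smul_comm s c, ← smul_add, ← smul_sub,
      RingHom.id_apply, Prod.smul_mk]

theorem pencilMap_injective {m n p : Type*} [Fintype m] [Fintype n] [Fintype p]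
    {M1 : Matrix m m ℝ} {M2 D : Matrix n n ℝ} {G : Matrix m n ℝ} {N : Matrix p n ℝ}
    (hM1 : M1.PosSemidef) (hM2 : M2.PosSemidef) (hD : D.PosDef)
    (hGN : Function.Injective fun x : (m → ℝ) × (p → ℝ) => Gᵀ.mulVec x.1 + Nᵀ.mulVec x.2)
    {s : ℝ} (hs : 0 ≤ s) : Function.Injective (pencilMap M1 M2 D G N s) := by
  rw [injective_iff_map_eq_zero]
  rintro ⟨x, y, z⟩ h
  obtain ⟨h1, h2, h3⟩ : s • M1.mulVec x + G.mulVec y = 0 ∧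
      s • M2.mulVec y - Gᵀ.mulVec x + D.mulVec y - Nᵀ.mulVec z = 0 ∧ N.mulVec y = 0 := by
    simpa [pencilMap] using h
  have hG : y ⬝ᵥ Gᵀ.mulVec x = x ⬝ᵥ G.mulVec y := by
    rw [mulVec_transpose, dotProduct_comm, dotProduct_mulVec]
  have hN : y ⬝ᵥ Nᵀ.mulVec z = z ⬝ᵥ N.mulVec y := by
    rw [mulVec_transpose, dotProduct_comm, dotProduct_mulVec]
  have hy : y = 0 := by
    by_contra hy
    have e1 := congrArg (x ⬝ᵥ ·) h1
    have e2 := congrArg (y ⬝ᵥ ·) h2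
    simp only [dotProduct_add, dotProduct_sub, dotProduct_smul, dotProduct_zero, smul_eq_mul,
      hG, hN, h3] at e1 e2
    have p1 : 0 ≤ x ⬝ᵥ M1.mulVec x := by simpa using hM1.dotProduct_mulVec_nonneg x
    have p2 : 0 ≤ y ⬝ᵥ M2.mulVec y := by simpa using hM2.dotProduct_mulVec_nonneg y
    have p3 : 0 < y ⬝ᵥ D.mulVec y := by simpa using hD.dotProduct_mulVec_pos hy
    linarith [mul_nonneg hs p1, mul_nonneg hs p2]
  subst hy
  have hxz : (x, z) = 0 := hGN <| by
    simp only [mulVec_zero, smul_zero, zero_sub, add_zero] at h2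
    rw [← neg_add', neg_eq_zero] at h2
    simpa using h2
  simp_all

/-- Under assumption (A0), the matrix pencil sE + A of the full order model is
regular for every s ≥ 0: the block linear system has a unique solution for
every right-hand side.  In particular (s = 0) the system matrix A is invertible. -/
theorem full_order_pencil_regular {k1 k2 k3 : ℕ}
    (M1 : Matrix (Fin k1) (Fin k1) ℝ) (M2 D : Matrix (Fin k2) (Fin k2) ℝ)
    (G : Matrix (Fin k1) (Fin k2) ℝ) (N : Matrix (Fin k3) (Fin k2) ℝ)
    (hM1 : M1.PosDef) (hM2 : M2.PosDef) (hD : D.PosDef)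
    (hGN : Function.Injective fun x : (Fin k1 → ℝ) × (Fin k3 → ℝ) =>
      Gᵀ.mulVec x.1 + Nᵀ.mulVec x.2) :
    ∀ s : ℝ, 0 ≤ s → ∀ (f1 : Fin k1 → ℝ) (f2 : Fin k2 → ℝ) (f3 : Fin k3 → ℝ),
      ∃! x : (Fin k1 → ℝ) × (Fin k2 → ℝ) × (Fin k3 → ℝ),
        s • M1.mulVec x.1 + G.mulVec x.2.1 = f1 ∧
        s • M2.mulVec x.2.1 - Gᵀ.mulVec x.1 + D.mulVec x.2.1 - Nᵀ.mulVec x.2.2 = f2 ∧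
        N.mulVec x.2.1 = f3 := by
  intro s hs f1 f2 f3
  have hinj := pencilMap_injective hM1.posSemidef hM2.posSemidef hD hGN hs
  have hbij : Function.Bijective (pencilMap M1 M2 D G N s) :=
    ⟨hinj, LinearMap.surjective_of_injective hinj⟩
  simpa [pencilMap] using hbij.existsUnique (f1, f2, f3)
end

section
/- Assume (A0), let V1 and V2 be injective, and assume (A2) and (A3). Then the reduced matrices M̂1 = V1ᵀ·M1·V1, M̂2 = V2ᵀ·M2·V2 and D̂ = V2ᵀ·D·V2 are symmetric positive definite, and the linear map (z1, z3) ↦ Ĝᵀ·z1 + N̂ᵀ·z3 from ℝ^{K1} × ℝ^{k3} to ℝ^{K2} is injective, where Ĝ = V1ᵀ·G·V2 and N̂ = N·V2. (That is, condition (Â0) holds for the reduced model.) -/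
open Matrix

/-- A congruence `Vᵀ * M * V` of a real positive definite matrix by an injective `V` is positive
definite. -/
theorem posDef_transpose_mul_mul_same {m n : Type*} [Fintype m] [Fintype n]
    {M : Matrix m m ℝ} (hM : M.PosDef) {V : Matrix m n ℝ} (hV : Function.Injective V.mulVec) :
    (Vᵀ * M * V).PosDef := by
  simpa only [conjTranspose_eq_transpose_of_trivial] using hM.conjTranspose_mul_mul_same hV

/-- Under (A0), injectivity of V1, V2 and the compatibility conditions (A2), (A3),
the reduced matrices satisfy the structural condition (Â0): M̂1, M̂2, D̂ are
symmetric positive definite and [Ĝᵀ, N̂ᵀ] has trivial nullspace. -/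
theorem reduced_model_A0 {k1 k2 k3 K1 K2 : ℕ}
    (M1 : Matrix (Fin k1) (Fin k1) ℝ) (M2 D : Matrix (Fin k2) (Fin k2) ℝ)
    (G : Matrix (Fin k1) (Fin k2) ℝ) (N : Matrix (Fin k3) (Fin k2) ℝ)
    (hM1 : M1.PosDef) (hM2 : M2.PosDef) (hD : D.PosDef)
    (hGN : Function.Injective fun x : (Fin k1 → ℝ) × (Fin k3 → ℝ) =>
      Gᵀ.mulVec x.1 + Nᵀ.mulVec x.2)
    (V1 : Matrix (Fin k1) (Fin K1) ℝ) (V2 : Matrix (Fin k2) (Fin K2) ℝ)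
    (hV1 : Function.Injective V1.mulVec) (hV2 : Function.Injective V2.mulVec)
    (hA2 : LinearMap.range (M1 * V1).mulVecLin = LinearMap.range (G * V2).mulVecLin)
    (hA3 : LinearMap.ker G.mulVecLin ≤ LinearMap.range V2.mulVecLin ∧
      Submodule.map N.mulVecLin (LinearMap.ker G.mulVecLin) = ⊤) :
    (V1ᵀ * M1 * V1).PosDef ∧ (V2ᵀ * M2 * V2).PosDef ∧ (V2ᵀ * D * V2).PosDef ∧
      Function.Injective fun z : (Fin K1 → ℝ) × (Fin k3 → ℝ) =>
        (V1ᵀ * G * V2)ᵀ.mulVec z.1 + (N * V2)ᵀ.mulVec z.2 := by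
  refine ⟨posDef_transpose_mul_mul_same hM1 hV1, posDef_transpose_mul_mul_same hM2 hV2,
    posDef_transpose_mul_mul_same hD hV2, ?_⟩
  let L : (Fin K1 → ℝ) × (Fin k3 → ℝ) →ₗ[ℝ] Fin K2 → ℝ :=
    (V1ᵀ * G * V2)ᵀ.mulVecLin.coprod (N * V2)ᵀ.mulVecLin
  change Function.Injective L
  rw [injective_iff_map_eq_zero]
  rintro ⟨z1, z3⟩ hz
  have hpair (y : Fin K2 → ℝ) :
      (V1 *ᵥ z1) ⬝ᵥ (G *ᵥ (V2 *ᵥ y)) + z3 ⬝ᵥ (N *ᵥ (V2 *ᵥ y)) = 0 := by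
    have h : ((V1ᵀ * G * V2)ᵀ *ᵥ z1 + (N * V2)ᵀ *ᵥ z3) ⬝ᵥ y = 0 := by
      have h0 : (V1ᵀ * G * V2)ᵀ *ᵥ z1 + (N * V2)ᵀ *ᵥ z3 = 0 := hz
      rw [h0, zero_dotProduct]
    rw [add_dotProduct, mulVec_transpose, mulVec_transpose, ← dotProduct_mulVec,
      ← dotProduct_mulVec, ← mulVec_mulVec, ← mulVec_mulVec, ← mulVec_mulVec,
      dotProduct_mulVec z1, vecMul_transpose] at h
    exact h
  have hz3 : z3 = 0 := by
    obtain ⟨w, hw, hNw⟩ : z3 ∈ Submodule.map N.mulVecLin (LinearMap.ker G.mulVecLin) := by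
      rw [hA3.2]
      trivial
    obtain ⟨y, rfl⟩ := hA3.1 hw
    have hGy : G *ᵥ (V2 *ᵥ y) = 0 := hw
    have hNy : N *ᵥ (V2 *ᵥ y) = z3 := hNw
    simpa [hGy, hNy] using hpair y
  have hz1 : z1 = 0 := by
    obtain ⟨y, hy⟩ : (M1 * V1) *ᵥ z1 ∈ LinearMap.range (G * V2).mulVecLin :=
      hA2 ▸ LinearMap.mem_range_self (M1 * V1).mulVecLin z1
    have hGy : G *ᵥ (V2 *ᵥ y) = M1 *ᵥ (V1 *ᵥ z1) := by
      simpa only [mulVecLin_apply, mulVec_mulVec] using hy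
    have h := hpair y
    rw [hz3, zero_dotProduct, add_zero, hGy] at h
    have hV : V1 *ᵥ z1 = 0 := by
      by_contra hne
      have hpos := hM1.dotProduct_mulVec_pos hne
      rw [star_trivial] at hpos
      exact hpos.ne' h
    exact hV1 (hV.trans (mulVec_zero V1).symm)
  rw [hz1, hz3, Prod.mk_zero_zero]
end

section
/- Assume (A0), let V1 and V2 be injective, and assume (A2) and (A3). Then for every real s ≥ 0 the reduced matrix pencil is regular; concretely, for every s ≥ 0 and every right-hand side (g1, g2, g3) ∈ ℝ^{K1} × ℝ^{K2} × ℝ^{k3} there exists a unique triple (z1, z2, z3) ∈ ℝ^{K1} × ℝ^{K2} × ℝ^{k3} with s·M̂1·z1 + Ĝ·z2 = g1, s·M̂2·z2 − Ĝᵀ·z1 + D̂·z2 − N̂ᵀ·z3 = g2 and N̂·z2 = g3. In particular the reduced system matrix Â with blocks [[0, Ĝ, 0], [−Ĝᵀ, D̂, −N̂ᵀ], [0, N̂, 0]] is invertible. -/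
open Matrix

/-- Moving the outer factors of a congruence-type product across the dot product. -/
lemma dotProduct_transpose_mul_mul_mulVec {l m n o : Type*} [Fintype l] [Fintype m] [Fintype n]
    [Fintype o] (A : Matrix l m ℝ) (B : Matrix l n ℝ) (C : Matrix n o ℝ) (x : m → ℝ) (y : o → ℝ) :
    x ⬝ᵥ (Aᵀ * B * C) *ᵥ y = (A *ᵥ x) ⬝ᵥ (B *ᵥ (C *ᵥ y)) := by
  rw [← mulVec_mulVec, ← mulVec_mulVec, dotProduct_mulVec, vecMul_transpose]

/-- The defining property of the transpose for the dot product. -/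
lemma dotProduct_transpose_mulVec_comm {m n : Type*} [Fintype m] [Fintype n]
    (A : Matrix m n ℝ) (x : n → ℝ) (y : m → ℝ) :
    x ⬝ᵥ Aᵀ *ᵥ y = y ⬝ᵥ A *ᵥ x := by
  rw [dotProduct_mulVec, vecMul_transpose, dotProduct_comm]

/-- The quadratic form of a real positive definite matrix is nonnegative. -/
lemma Matrix.PosDef.dotProduct_mulVec_self_nonneg {n : Type*} [Fintype n] {A : Matrix n n ℝ}
    (hA : A.PosDef) (x : n → ℝ) : 0 ≤ x ⬝ᵥ A *ᵥ x := by
  simpa using hA.posSemidef.dotProduct_mulVec_nonneg x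

/-- The quadratic form of a real positive definite matrix is definite. -/
lemma Matrix.PosDef.eq_zero_of_dotProduct_mulVec_self_nonpos {n : Type*} [Fintype n]
    {A : Matrix n n ℝ} (hA : A.PosDef) {x : n → ℝ} (hx : x ⬝ᵥ A *ᵥ x ≤ 0) : x = 0 := by
  by_contra h
  have := hA.dotProduct_mulVec_pos h
  simp only [star_trivial] at this
  linarith

/-- The linear map of the block system
`[[A, B, 0], [-Bᵀ, C, -Nᵀ], [0, N, 0]]`, with `C` split into two summands. -/
def saddlePointMap {m n p : Type*} [Fintype m] [Fintype n] [Fintype p] (s : ℝ)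
    (A : Matrix m m ℝ) (B : Matrix m n ℝ) (C D : Matrix n n ℝ) (N : Matrix p n ℝ) :
    (m → ℝ) × (n → ℝ) × (p → ℝ) →ₗ[ℝ] (m → ℝ) × (n → ℝ) × (p → ℝ) where
  toFun z := (s • A *ᵥ z.1 + B *ᵥ z.2.1,
    s • C *ᵥ z.2.1 - Bᵀ *ᵥ z.1 + D *ᵥ z.2.1 - Nᵀ *ᵥ z.2.2, N *ᵥ z.2.1)
  map_add' x y := by
    simp only [Prod.fst_add, Prod.snd_add, mulVec_add, smul_add, Prod.mk_add_mk, Prod.mk.injEq]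
    refine ⟨by abel, by abel, trivial⟩
  map_smul' c x := by
    simp only [Prod.smul_fst, Prod.smul_snd, mulVec_smul, Prod.smul_mk, smul_add, smul_sub,
      smul_comm s c, RingHom.id_apply]

/-- Under (A0), injectivity of V1, V2 and the compatibility conditions (A2), (A3),
the reduced matrix pencil s·Ê + Â is regular for every s ≥ 0: the reduced block
linear system has a unique solution for every right-hand side.  In particular
(s = 0) the reduced system matrix Â is invertible. -/
theorem reduced_pencil_regular {k1 k2 k3 K1 K2 : ℕ}
    (M1 : Matrix (Fin k1) (Fin k1) ℝ) (M2 D : Matrix (Fin k2) (Fin k2) ℝ)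
    (G : Matrix (Fin k1) (Fin k2) ℝ) (N : Matrix (Fin k3) (Fin k2) ℝ)
    (hM1 : M1.PosDef) (hM2 : M2.PosDef) (hD : D.PosDef)
    (hGN : Function.Injective fun x : (Fin k1 → ℝ) × (Fin k3 → ℝ) =>
      Gᵀ.mulVec x.1 + Nᵀ.mulVec x.2)
    (V1 : Matrix (Fin k1) (Fin K1) ℝ) (V2 : Matrix (Fin k2) (Fin K2) ℝ)
    (hV1 : Function.Injective V1.mulVec) (hV2 : Function.Injective V2.mulVec)
    (hA2 : LinearMap.range (M1 * V1).mulVecLin = LinearMap.range (G * V2).mulVecLin)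
    (hA3 : LinearMap.ker G.mulVecLin ≤ LinearMap.range V2.mulVecLin ∧
      Submodule.map N.mulVecLin (LinearMap.ker G.mulVecLin) = ⊤) :
    ∀ s : ℝ, 0 ≤ s → ∀ (g1 : Fin K1 → ℝ) (g2 : Fin K2 → ℝ) (g3 : Fin k3 → ℝ),
      ∃! z : (Fin K1 → ℝ) × (Fin K2 → ℝ) × (Fin k3 → ℝ),
        s • (V1ᵀ * M1 * V1).mulVec z.1 + (V1ᵀ * G * V2).mulVec z.2.1 = g1 ∧
        s • (V2ᵀ * M2 * V2).mulVec z.2.1 - (V1ᵀ * G * V2)ᵀ.mulVec z.1 +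
          (V2ᵀ * D * V2).mulVec z.2.1 - (N * V2)ᵀ.mulVec z.2.2 = g2 ∧
        (N * V2).mulVec z.2.1 = g3 := by
  intro s hs g1 g2 g3
  let L := saddlePointMap s (V1ᵀ * M1 * V1) (V1ᵀ * G * V2) (V2ᵀ * M2 * V2) (V2ᵀ * D * V2) (N * V2)
  have hinj : Function.Injective L := by
    refine (injective_iff_map_eq_zero L).2 ?_
    rintro ⟨z1, z2, z3⟩ hz
    obtain ⟨e1, e2, e3⟩ : s • (V1ᵀ * M1 * V1) *ᵥ z1 + (V1ᵀ * G * V2) *ᵥ z2 = 0 ∧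
        s • (V2ᵀ * M2 * V2) *ᵥ z2 - (V1ᵀ * G * V2)ᵀ *ᵥ z1 +
          (V2ᵀ * D * V2) *ᵥ z2 - (N * V2)ᵀ *ᵥ z3 = 0 ∧
        (N * V2) *ᵥ z2 = 0 := by
      simpa [L, saddlePointMap] using hz
    have hz2 : z2 = 0 := by
      have h1 := congrArg (z1 ⬝ᵥ ·) e1
      have h2 := congrArg (z2 ⬝ᵥ ·) e2
      simp only [dotProduct_add, dotProduct_sub, dotProduct_smul, dotProduct_zero, smul_eq_mul,
        dotProduct_transpose_mulVec_comm, e3, dotProduct_transpose_mul_mul_mulVec] at h1 h2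
      have p1 := mul_nonneg hs (hM1.dotProduct_mulVec_self_nonneg (V1 *ᵥ z1))
      have p2 := mul_nonneg hs (hM2.dotProduct_mulVec_self_nonneg (V2 *ᵥ z2))
      refine hV2 ?_
      rw [mulVec_zero]
      exact hD.eq_zero_of_dotProduct_mulVec_self_nonpos (by linarith)
    subst hz2
    have key (y : Fin K2 → ℝ) :
        (V1 *ᵥ z1) ⬝ᵥ (G *ᵥ (V2 *ᵥ y)) + z3 ⬝ᵥ (N *ᵥ (V2 *ᵥ y)) = 0 := by
      have h2 := congrArg (y ⬝ᵥ ·) e2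
      simp only [dotProduct_add, dotProduct_sub, dotProduct_zero, mulVec_zero, smul_zero,
        dotProduct_transpose_mulVec_comm, dotProduct_transpose_mul_mul_mulVec] at h2
      rw [← mulVec_mulVec y N V2] at h2
      linarith
    have hker (t : Fin k3 → ℝ) : ∃ u, G *ᵥ (V2 *ᵥ u) = 0 ∧ N *ᵥ (V2 *ᵥ u) = t := by
      obtain ⟨k, hk, hkt⟩ : t ∈ Submodule.map N.mulVecLin (LinearMap.ker G.mulVecLin) :=
        hA3.2 ▸ Submodule.mem_top
      obtain ⟨u, rfl⟩ := hA3.1 hk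
      exact ⟨u, hk, hkt⟩
    have hz1 : z1 = 0 := by
      obtain ⟨w, hw⟩ : (M1 * V1) *ᵥ z1 ∈ LinearMap.range (G * V2).mulVecLin :=
        hA2 ▸ ⟨z1, rfl⟩
      rw [mulVecLin_apply, ← mulVec_mulVec, ← mulVec_mulVec] at hw
      obtain ⟨u, hGu, hNu⟩ := hker (N *ᵥ (V2 *ᵥ w))
      have h := key (w - u)
      simp only [mulVec_sub, hGu, hNu, hw, sub_zero, sub_self, dotProduct_zero, add_zero] at h
      refine hV1 ?_
      rw [mulVec_zero]
      exact hM1.eq_zero_of_dotProduct_mulVec_self_nonpos h.le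
    have hz3 : z3 = 0 := by
      obtain ⟨u, hGu, hNu⟩ := hker z3
      have h := key u
      rw [hGu, hNu, dotProduct_zero, zero_add] at h
      exact dotProduct_self_eq_zero.1 h
    rw [hz1, hz3]
    rfl
  have hbij : Function.Bijective L := ⟨hinj, LinearMap.injective_iff_surjective.1 hinj⟩
  simpa only [L, saddlePointMap, LinearMap.coe_mk, AddHom.coe_mk, Prod.mk.injEq] using
    hbij.existsUnique (g1, g2, g3)
end

section
/- (Moment matching.) Assume (A0), let s0 ≥ 0, let B2 be a real k2×m matrix, and let (X1^l, X2^l, X3^l) for l ≥ 0 be the full Krylov iterates: (X1^0, X2^0, X3^0) is the unique solution of s0·M1·X1^0 + G·X2^0 = 0, s0·M2·X2^0 − Gᵀ·X1^0 + D·X2^0 − Nᵀ·X3^0 = B2, N·X2^0 = 0, and for l ≥ 1, (X1^l, X2^l, X3^l) is the unique solution of the same system with right-hand sides M1·X1^{l−1}, M2·X2^{l−1}, 0, respectively; set m_l = B2ᵀ·X2^l. Let V1, V2 be injective satisfying (A2) and (A3), set B̂2 = V2ᵀ·B2, and let (Z1^l, Z2^l, Z3^l) be the analogous reduced Krylov iterates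 built from M̂1, M̂2, D̂, Ĝ, N̂, B̂2 (these exist and are unique); set m̂_l = B̂2ᵀ·Z2^l. If, for a given L ≥ 1, every column of X1^l lies in the range of V1 and every column of X2^l lies in the range of V2 for all 0 ≤ l ≤ L−1, then m̂_l = m_l for all 0 ≤ l ≤ 2L−1. -/
open Matrix

/-- The matrices `X1, X2, X3` solve the shifted saddle point system with right-hand side
`(F1, F2, 0)`. -/
def SaddleSolution {a b c m : ℕ} (s0 : ℝ)
    (M1 : Matrix (Fin a) (Fin a) ℝ) (M2 D : Matrix (Fin b) (Fin b) ℝ)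
    (G : Matrix (Fin a) (Fin b) ℝ) (N : Matrix (Fin c) (Fin b) ℝ)
    (X1 : Matrix (Fin a) (Fin m) ℝ) (X2 : Matrix (Fin b) (Fin m) ℝ)
    (X3 : Matrix (Fin c) (Fin m) ℝ)
    (F1 : Matrix (Fin a) (Fin m) ℝ) (F2 : Matrix (Fin b) (Fin m) ℝ) : Prop :=
  s0 • (M1 * X1) + G * X2 = F1 ∧
    s0 • (M2 * X2) - Gᵀ * X1 + D * X2 - Nᵀ * X3 = F2 ∧
    N * X2 = 0

namespace SaddleSolution

variable {a b c m : ℕ} {s0 : ℝ}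
  {M1 : Matrix (Fin a) (Fin a) ℝ} {M2 D : Matrix (Fin b) (Fin b) ℝ}
  {G : Matrix (Fin a) (Fin b) ℝ} {N : Matrix (Fin c) (Fin b) ℝ}

/-- Reciprocity: the saddle point operator is symmetric up to a change of signs. -/
theorem reciprocity (hM1 : M1ᵀ = M1) (hM2 : M2ᵀ = M2) (hD : Dᵀ = D)
    {X1 Y1 F1 H1 : Matrix (Fin a) (Fin m) ℝ} {X2 Y2 F2 H2 : Matrix (Fin b) (Fin m) ℝ}
    {X3 Y3 : Matrix (Fin c) (Fin m) ℝ}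
    (hX : SaddleSolution s0 M1 M2 D G N X1 X2 X3 F1 F2)
    (hY : SaddleSolution s0 M1 M2 D G N Y1 Y2 Y3 H1 H2) :
    Y2ᵀ * F2 - Y1ᵀ * F1 = H2ᵀ * X2 - H1ᵀ * X1 := by
  obtain ⟨rfl, rfl, hX3⟩ := hX
  obtain ⟨rfl, rfl, hY3⟩ := hY
  have hY3' : Y2ᵀ * Nᵀ = 0 := by rw [← transpose_mul, hY3, transpose_zero]
  simp only [transpose_add, transpose_sub, transpose_smul, transpose_mul, transpose_transpose,
    hM1, hM2, hD, Matrix.mul_add, Matrix.mul_sub, Matrix.add_mul, Matrix.sub_mul,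
    Matrix.mul_smul, Matrix.smul_mul, Matrix.mul_assoc, hX3, Matrix.mul_zero]
  rw [← Matrix.mul_assoc Y2ᵀ Nᵀ, hY3', Matrix.zero_mul]
  abel

theorem sub {X1 Y1 F1 H1 : Matrix (Fin a) (Fin m) ℝ} {X2 Y2 F2 H2 : Matrix (Fin b) (Fin m) ℝ}
    {X3 Y3 : Matrix (Fin c) (Fin m) ℝ}
    (hX : SaddleSolution s0 M1 M2 D G N X1 X2 X3 F1 F2)
    (hY : SaddleSolution s0 M1 M2 D G N Y1 Y2 Y3 H1 H2) :
    SaddleSolution s0 M1 M2 D G N (X1 - Y1) (X2 - Y2) (X3 - Y3) (F1 - H1) (F2 - H2) := by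
  obtain ⟨rfl, rfl, hX3⟩ := hX
  obtain ⟨rfl, rfl, hY3⟩ := hY
  refine ⟨?_, ?_, ?_⟩
  · simp only [Matrix.mul_sub, smul_sub]
    abel
  · simp only [Matrix.mul_sub, smul_sub]
    abel
  · rw [Matrix.mul_sub, hX3, hY3, sub_zero]

theorem eq_zero (hs0 : 0 ≤ s0) (hM1 : M1.PosSemidef) (hM2 : M2.PosSemidef) (hD : D.PosDef)
    (hGN : ∀ x z, Gᵀ *ᵥ x + Nᵀ *ᵥ z = 0 → x = 0)
    {X1 : Matrix (Fin a) (Fin m) ℝ} {X2 : Matrix (Fin b) (Fin m) ℝ}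
    {X3 : Matrix (Fin c) (Fin m) ℝ} (h : SaddleSolution s0 M1 M2 D G N X1 X2 X3 0 0) :
    X1 = 0 ∧ X2 = 0 := by
  suffices H : ∀ e, X1 *ᵥ e = 0 ∧ X2 *ᵥ e = 0 from
    ⟨ext_iff_mulVec.2 fun e => by simpa using (H e).1,
      ext_iff_mulVec.2 fun e => by simpa using (H e).2⟩
  intro e
  obtain ⟨h1, h2, h3⟩ := h
  replace h1 := congrArg (· *ᵥ e) h1
  replace h2 := congrArg (· *ᵥ e) h2
  replace h3 := congrArg (· *ᵥ e) h3
  simp only [add_mulVec, sub_mulVec, smul_mulVec, ← mulVec_mulVec, zero_mulVec] at h1 h2 h3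
  generalize X1 *ᵥ e = x at *
  generalize X2 *ᵥ e = y at *
  generalize X3 *ᵥ e = z at *
  have hy : y = 0 := by
    by_contra hy
    have e1 := congrArg (x ⬝ᵥ ·) h1
    have e2 := congrArg (y ⬝ᵥ ·) h2
    have eG : y ⬝ᵥ Gᵀ *ᵥ x = x ⬝ᵥ G *ᵥ y := by
      rw [mulVec_transpose, dotProduct_comm, dotProduct_mulVec]
    have eN : y ⬝ᵥ Nᵀ *ᵥ z = 0 := by
      rw [mulVec_transpose, dotProduct_comm, ← dotProduct_mulVec, h3, dotProduct_zero]
    simp only [dotProduct_add, dotProduct_sub, dotProduct_smul, dotProduct_zero, smul_eq_mul,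
      eG, eN] at e1 e2
    have p1 := mul_nonneg hs0 (hM1.dotProduct_mulVec_nonneg x)
    have p2 := mul_nonneg hs0 (hM2.dotProduct_mulVec_nonneg y)
    have p3 := hD.dotProduct_mulVec_pos hy
    simp only [star_trivial] at p1 p2 p3
    linarith
  subst hy
  refine ⟨hGN x z ?_, rfl⟩
  simp only [mulVec_zero, smul_zero, zero_sub, add_zero] at h2
  rw [← neg_eq_zero, ← h2]
  abel

/-- Galerkin projection of a solution lying in the range of the trial spaces. -/
theorem project {a' b' : ℕ} {V1 : Matrix (Fin a) (Fin a') ℝ} {V2 : Matrix (Fin b) (Fin b') ℝ}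
    {Y1 : Matrix (Fin a') (Fin m) ℝ} {Y2 : Matrix (Fin b') (Fin m) ℝ}
    {X3 : Matrix (Fin c) (Fin m) ℝ}
    {F1 : Matrix (Fin a) (Fin m) ℝ} {F2 : Matrix (Fin b) (Fin m) ℝ}
    (h : SaddleSolution s0 M1 M2 D G N (V1 * Y1) (V2 * Y2) X3 F1 F2) :
    SaddleSolution s0 (V1ᵀ * M1 * V1) (V2ᵀ * M2 * V2) (V2ᵀ * D * V2) (V1ᵀ * G * V2) (N * V2)
      Y1 Y2 X3 (V1ᵀ * F1) (V2ᵀ * F2) := by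
  obtain ⟨rfl, rfl, h3⟩ := h
  refine ⟨?_, ?_, ?_⟩
  · simp only [Matrix.mul_add, Matrix.mul_smul, Matrix.mul_assoc]
  · simp only [Matrix.mul_add, Matrix.mul_sub, Matrix.mul_smul, Matrix.mul_assoc, transpose_mul,
      transpose_transpose]
  · rw [Matrix.mul_assoc, h3]

/-- The moment of index `i + j + 1` depends only on the Krylov iterates of index `i` and `j`. -/
theorem moment_eq (hM1 : M1ᵀ = M1) (hM2 : M2ᵀ = M2) (hD : Dᵀ = D)
    {B : Matrix (Fin b) (Fin m) ℝ} {X1 : ℕ → Matrix (Fin a) (Fin m) ℝ}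
    {X2 : ℕ → Matrix (Fin b) (Fin m) ℝ} {X3 : ℕ → Matrix (Fin c) (Fin m) ℝ}
    (h0 : SaddleSolution s0 M1 M2 D G N (X1 0) (X2 0) (X3 0) 0 B)
    (hS : ∀ l, SaddleSolution s0 M1 M2 D G N (X1 (l + 1)) (X2 (l + 1)) (X3 (l + 1))
      (M1 * X1 l) (M2 * X2 l)) (i j : ℕ) :
    Bᵀ * X2 (i + j + 1) = (X2 i)ᵀ * (M2 * X2 j) - (X1 i)ᵀ * (M1 * X1 j) := by
  induction i generalizing j with
  | zero => simpa using ((hS j).reciprocity hM1 hM2 hD h0).symm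
  | succ i ih =>
    rw [show i + 1 + j + 1 = i + (j + 1) + 1 by omega, ih,
      (hS j).reciprocity hM1 hM2 hD (hS i)]
    simp only [transpose_mul, hM1, hM2, Matrix.mul_assoc]

end SaddleSolution

theorem exists_eq_mul_of_col_mem_range {a b m : ℕ} {V : Matrix (Fin a) (Fin b) ℝ}
    {X : Matrix (Fin a) (Fin m) ℝ}
    (h : ∀ j, (fun i => X i j) ∈ LinearMap.range V.mulVecLin) : ∃ Y, X = V * Y := by
  choose f hf using h
  refine ⟨(of f)ᵀ, ?_⟩
  ext i j
  exact (congrFun (hf j) i).symm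

/-- Compatibility of the trial spaces makes the reduced constraint operator injective in its first
argument. -/
theorem reduced_constraint_injective {k1 k2 k3 K1 K2 : ℕ} {M1 : Matrix (Fin k1) (Fin k1) ℝ}
    {G : Matrix (Fin k1) (Fin k2) ℝ} {N : Matrix (Fin k3) (Fin k2) ℝ}
    {V1 : Matrix (Fin k1) (Fin K1) ℝ} {V2 : Matrix (Fin k2) (Fin K2) ℝ}
    (hM1 : M1.PosDef) (hV1 : Function.Injective V1.mulVec)
    (hrange : LinearMap.range (M1 * V1).mulVecLin ≤ LinearMap.range (G * V2).mulVecLin)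
    (hker : LinearMap.ker G.mulVecLin ≤ LinearMap.range V2.mulVecLin)
    (hN : Submodule.map N.mulVecLin (LinearMap.ker G.mulVecLin) = ⊤)
    (x : Fin K1 → ℝ) (z : Fin k3 → ℝ)
    (h : (V1ᵀ * G * V2)ᵀ *ᵥ x + (N * V2)ᵀ *ᵥ z = 0) : x = 0 := by
  obtain ⟨y, hy⟩ := hrange ⟨x, rfl⟩
  obtain ⟨w, hwG, hwN⟩ : N *ᵥ (V2 *ᵥ y) ∈ Submodule.map N.mulVecLin (LinearMap.ker G.mulVecLin) :=
    hN ▸ Submodule.mem_top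
  obtain ⟨v, rfl⟩ := hker hwG
  simp only [SetLike.mem_coe, LinearMap.mem_ker, mulVecLin_apply, ← mulVec_mulVec] at hy hwG hwN
  have key := congrArg ((y - v) ⬝ᵥ ·) h
  simp only [dotProduct_add, mulVec_transpose, dotProduct_zero] at key
  rw [dotProduct_comm, ← dotProduct_mulVec, dotProduct_comm (y - v), ← dotProduct_mulVec] at key
  simp only [← mulVec_mulVec, mulVec_sub, hwG, hwN, hy, sub_self, sub_zero, mulVec_zero,
    dotProduct_zero, add_zero] at key
  by_contra hx
  have hVx : V1 *ᵥ x ≠ 0 := fun h0 => hx (hV1 (h0.trans (mulVec_zero V1).symm))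
  have hpos := hM1.dotProduct_mulVec_pos hVx
  rw [star_trivial] at hpos
  rw [mulVec_transpose, dotProduct_comm, ← dotProduct_mulVec, dotProduct_comm] at key
  exact hpos.ne' key

/-- Moment matching: if the first L full Krylov iterates are contained (columnwise)
in the ranges of the projection matrices V1, V2, then the first 2L moments of the
reduced model coincide with those of the full order model. -/
theorem moment_matching {k1 k2 k3 m K1 K2 : ℕ}
    (M1 : Matrix (Fin k1) (Fin k1) ℝ) (M2 D : Matrix (Fin k2) (Fin k2) ℝ)
    (G : Matrix (Fin k1) (Fin k2) ℝ) (N : Matrix (Fin k3) (Fin k2) ℝ)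
    (B2 : Matrix (Fin k2) (Fin m) ℝ)
    (hM1 : M1.PosDef) (hM2 : M2.PosDef) (hD : D.PosDef)
    (hGN : Function.Injective fun x : (Fin k1 → ℝ) × (Fin k3 → ℝ) =>
      Gᵀ.mulVec x.1 + Nᵀ.mulVec x.2)
    (V1 : Matrix (Fin k1) (Fin K1) ℝ) (V2 : Matrix (Fin k2) (Fin K2) ℝ)
    (hV1 : Function.Injective V1.mulVec) (hV2 : Function.Injective V2.mulVec)
    (hA2 : LinearMap.range (M1 * V1).mulVecLin = LinearMap.range (G * V2).mulVecLin)
    (hA3 : LinearMap.ker G.mulVecLin ≤ LinearMap.range V2.mulVecLin ∧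
      Submodule.map N.mulVecLin (LinearMap.ker G.mulVecLin) = ⊤)
    (s0 : ℝ) (hs0 : 0 ≤ s0)
    -- full Krylov iterates
    (X1 : ℕ → Matrix (Fin k1) (Fin m) ℝ) (X2 : ℕ → Matrix (Fin k2) (Fin m) ℝ)
    (X3 : ℕ → Matrix (Fin k3) (Fin m) ℝ)
    (hX0 : s0 • (M1 * X1 0) + G * X2 0 = 0 ∧
      s0 • (M2 * X2 0) - Gᵀ * X1 0 + D * X2 0 - Nᵀ * X3 0 = B2 ∧
      N * X2 0 = 0)
    (hX : ∀ l : ℕ, 1 ≤ l →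
      s0 • (M1 * X1 l) + G * X2 l = M1 * X1 (l - 1) ∧
      s0 • (M2 * X2 l) - Gᵀ * X1 l + D * X2 l - Nᵀ * X3 l = M2 * X2 (l - 1) ∧
      N * X2 l = 0)
    -- reduced Krylov iterates
    (Z1 : ℕ → Matrix (Fin K1) (Fin m) ℝ) (Z2 : ℕ → Matrix (Fin K2) (Fin m) ℝ)
    (Z3 : ℕ → Matrix (Fin k3) (Fin m) ℝ)
    (hZ0 : s0 • ((V1ᵀ * M1 * V1) * Z1 0) + (V1ᵀ * G * V2) * Z2 0 = 0 ∧
      s0 • ((V2ᵀ * M2 * V2) * Z2 0) - (V1ᵀ * G * V2)ᵀ * Z1 0 +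
        (V2ᵀ * D * V2) * Z2 0 - (N * V2)ᵀ * Z3 0 = V2ᵀ * B2 ∧
      (N * V2) * Z2 0 = 0)
    (hZ : ∀ l : ℕ, 1 ≤ l →
      s0 • ((V1ᵀ * M1 * V1) * Z1 l) + (V1ᵀ * G * V2) * Z2 l = (V1ᵀ * M1 * V1) * Z1 (l - 1) ∧
      s0 • ((V2ᵀ * M2 * V2) * Z2 l) - (V1ᵀ * G * V2)ᵀ * Z1 l +
        (V2ᵀ * D * V2) * Z2 l - (N * V2)ᵀ * Z3 l = (V2ᵀ * M2 * V2) * Z2 (l - 1) ∧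
      (N * V2) * Z2 l = 0)
    (L : ℕ) (hL : 1 ≤ L)
    (hcols : ∀ l : ℕ, l ≤ L - 1 →
      (∀ j : Fin m, (fun i => X1 l i j) ∈ LinearMap.range V1.mulVecLin) ∧
      (∀ j : Fin m, (fun i => X2 l i j) ∈ LinearMap.range V2.mulVecLin)) :
    ∀ l : ℕ, l ≤ 2 * L - 1 → (V2ᵀ * B2)ᵀ * Z2 l = B2ᵀ * X2 l := by
  have symm {n : ℕ} {A : Matrix (Fin n) (Fin n) ℝ} (hA : A.PosDef) : Aᵀ = A := by
    rw [← conjTranspose_eq_transpose_of_trivial]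
    exact hA.isHermitian
  have pd {n p : ℕ} {A : Matrix (Fin n) (Fin n) ℝ} {V : Matrix (Fin n) (Fin p) ℝ}
      (hA : A.PosDef) (hV : Function.Injective V.mulVec) : (Vᵀ * A * V).PosDef := by
    rw [← conjTranspose_eq_transpose_of_trivial]
    exact hA.conjTranspose_mul_mul_same hV
  have hXS (l : ℕ) : SaddleSolution s0 M1 M2 D G N (X1 (l + 1)) (X2 (l + 1)) (X3 (l + 1))
      (M1 * X1 l) (M2 * X2 l) := hX (l + 1) (Nat.le_add_left 1 l)
  have hZS (l : ℕ) : SaddleSolution s0 (V1ᵀ * M1 * V1) (V2ᵀ * M2 * V2) (V2ᵀ * D * V2)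
      (V1ᵀ * G * V2) (N * V2) (Z1 (l + 1)) (Z2 (l + 1)) (Z3 (l + 1))
      (V1ᵀ * M1 * V1 * Z1 l) (V2ᵀ * M2 * V2 * Z2 l) := hZ (l + 1) (Nat.le_add_left 1 l)
  have unique {X1 Y1 F1 : Matrix (Fin K1) (Fin m) ℝ} {X2 Y2 F2 : Matrix (Fin K2) (Fin m) ℝ}
      {X3 Y3 : Matrix (Fin k3) (Fin m) ℝ}
      (hX : SaddleSolution s0 (V1ᵀ * M1 * V1) (V2ᵀ * M2 * V2) (V2ᵀ * D * V2) (V1ᵀ * G * V2)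
        (N * V2) X1 X2 X3 F1 F2)
      (hY : SaddleSolution s0 (V1ᵀ * M1 * V1) (V2ᵀ * M2 * V2) (V2ᵀ * D * V2) (V1ᵀ * G * V2)
        (N * V2) Y1 Y2 Y3 F1 F2) : X1 = Y1 ∧ X2 = Y2 := by
    have h := hX.sub hY
    rw [sub_self, sub_self] at h
    have h' := h.eq_zero hs0 (pd hM1 hV1).posSemidef (pd hM2 hV2).posSemidef (pd hD hV2)
      (reduced_constraint_injective hM1 hV1 hA2.le hA3.1 hA3.2)
    exact ⟨sub_eq_zero.1 h'.1, sub_eq_zero.1 h'.2⟩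
  have iterates (l : ℕ) (hl : l ≤ L - 1) : X1 l = V1 * Z1 l ∧ X2 l = V2 * Z2 l := by
    induction l with
    | zero =>
      obtain ⟨Y1, hY1⟩ := exists_eq_mul_of_col_mem_range (hcols 0 hl).1
      obtain ⟨Y2, hY2⟩ := exists_eq_mul_of_col_mem_range (hcols 0 hl).2
      have hS : SaddleSolution s0 M1 M2 D G N (X1 0) (X2 0) (X3 0) 0 B2 := hX0
      rw [hY1, hY2] at hS
      have hP := hS.project
      rw [Matrix.mul_zero] at hP
      obtain ⟨rfl, rfl⟩ := unique hP hZ0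
      exact ⟨hY1, hY2⟩
    | succ l ih =>
      obtain ⟨Y1, hY1⟩ := exists_eq_mul_of_col_mem_range (hcols (l + 1) hl).1
      obtain ⟨Y2, hY2⟩ := exists_eq_mul_of_col_mem_range (hcols (l + 1) hl).2
      obtain ⟨ih1, ih2⟩ := ih (by omega)
      have hS := hXS l
      rw [hY1, hY2, ih1, ih2] at hS
      have hP := hS.project
      simp only [← Matrix.mul_assoc] at hP
      obtain ⟨rfl, rfl⟩ := unique hP (hZS l)
      exact ⟨hY1, hY2⟩
  intro l hl
  by_cases hlL : l ≤ L - 1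
  · rw [(iterates l hlL).2, transpose_mul, transpose_transpose, Matrix.mul_assoc]
  · obtain ⟨j, hj, rfl⟩ : ∃ j, j ≤ L - 1 ∧ l = L - 1 + j + 1 :=
      ⟨l - L, by omega, by omega⟩
    rw [SaddleSolution.moment_eq (symm hM1) (symm hM2) (symm hD) hX0 hXS,
      SaddleSolution.moment_eq (symm (pd hM1 hV1)) (symm (pd hM2 hV2)) (symm (pd hD hV2)) hZ0 hZS,
      (iterates _ le_rfl).1, (iterates _ le_rfl).2, (iterates j hj).1, (iterates j hj).2]
    simp only [transpose_mul, Matrix.mul_assoc]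
end

section
/- Let s0 > 0, let b ∈ ℝ^{k2}, and let vectors (x1^l, x2^l, x3^l) ∈ ℝ^{k1} × ℝ^{k2} × ℝ^{k3} for 0 ≤ l ≤ L−1 satisfy the Krylov recursion: s0·M1·x1^0 + G·x2^0 = 0, s0·M2·x2^0 − Gᵀ·x1^0 + D·x2^0 + Nᵀ·x3^0 = b, N·x2^0 = 0, and for 1 ≤ l ≤ L−1: s0·M1·x1^l + G·x2^l = M1·x1^{l−1}, s0·M2·x2^l − Gᵀ·x1^l + D·x2^l + Nᵀ·x3^l = M2·x2^{l−1}, N·x2^l = 0. Then the image under the linear map x ↦ M1·x of the span of {x1^0, …, x1^{L−1}} equals the image under the linear map x ↦ G·x of the span of {x2^0, …, x2^{L−1}}. -/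
open Matrix

theorem span_image_Iio_eq_of_shift_recurrence {K V : Type*} [Field K] [AddCommGroup V] [Module K V]
    {u v : ℕ → V} {s : K} (hs : s ≠ 0) {L : ℕ} (h0 : s • u 0 + v 0 = 0)
    (hrec : ∀ l, l + 1 < L → s • u (l + 1) + v (l + 1) = u l) :
    Submodule.span K (u '' Set.Iio L) = Submodule.span K (v '' Set.Iio L) := by
  apply le_antisymm <;> rw [Submodule.span_le]
  · rintro _ ⟨l, hl, rfl⟩
    have hv : ∀ i < L, v i ∈ Submodule.span K (v '' Set.Iio L) := fun i hi ↦
      Submodule.subset_span ⟨i, hi, rfl⟩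
    rw [Set.mem_Iio] at hl
    induction l with
    | zero =>
      refine (Submodule.smul_mem_iff _ hs).1 ?_
      rw [eq_neg_of_add_eq_zero_left h0]
      exact neg_mem (hv 0 hl)
    | succ l ih =>
      refine (Submodule.smul_mem_iff _ hs).1 ?_
      rw [eq_sub_of_add_eq (hrec l hl)]
      exact sub_mem (ih (by lia)) (hv _ hl)
  · rintro _ ⟨l, hl, rfl⟩
    have hu : ∀ i < L, u i ∈ Submodule.span K (u '' Set.Iio L) := fun i hi ↦
      Submodule.subset_span ⟨i, hi, rfl⟩
    rw [Set.mem_Iio] at hl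
    cases l with
    | zero =>
      rw [eq_neg_of_add_eq_zero_right h0]
      exact neg_mem (Submodule.smul_mem _ _ (hu 0 hl))
    | succ l =>
      rw [eq_sub_of_add_eq' (hrec l hl)]
      exact sub_mem (hu l (by lia)) (Submodule.smul_mem _ _ (hu _ hl))

/-- For shift parameter s0 > 0, the Krylov iterates satisfy
M1·span{x1⁰,…,x1^{L-1}} = G·span{x2⁰,…,x2^{L-1}}. -/
theorem krylov_subspace_relation_pos_shift {k1 k2 k3 : ℕ}
    (M1 : Matrix (Fin k1) (Fin k1) ℝ) (M2 D : Matrix (Fin k2) (Fin k2) ℝ)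
    (G : Matrix (Fin k1) (Fin k2) ℝ) (N : Matrix (Fin k3) (Fin k2) ℝ)
    (L : ℕ) (hL : 1 ≤ L)
    (s0 : ℝ) (hs0 : 0 < s0) (b : Fin k2 → ℝ)
    (x1 : ℕ → Fin k1 → ℝ) (x2 : ℕ → Fin k2 → ℝ) (x3 : ℕ → Fin k3 → ℝ)
    (h0 : s0 • M1.mulVec (x1 0) + G.mulVec (x2 0) = 0 ∧
      s0 • M2.mulVec (x2 0) - Gᵀ.mulVec (x1 0) + D.mulVec (x2 0) + Nᵀ.mulVec (x3 0) = b ∧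
      N.mulVec (x2 0) = 0)
    (hrec : ∀ l : ℕ, 1 ≤ l → l ≤ L - 1 →
      s0 • M1.mulVec (x1 l) + G.mulVec (x2 l) = M1.mulVec (x1 (l - 1)) ∧
      s0 • M2.mulVec (x2 l) - Gᵀ.mulVec (x1 l) + D.mulVec (x2 l) + Nᵀ.mulVec (x3 l) =
        M2.mulVec (x2 (l - 1)) ∧
      N.mulVec (x2 l) = 0) :
    Submodule.map M1.mulVecLin (Submodule.span ℝ (x1 '' Set.Iio L)) =
      Submodule.map G.mulVecLin (Submodule.span ℝ (x2 '' Set.Iio L)) := by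
  rw [Submodule.map_span, Submodule.map_span, Set.image_image, Set.image_image]
  exact span_image_Iio_eq_of_shift_recurrence hs0.ne' h0.1 fun l hl ↦
    (hrec (l + 1) (by lia) (by lia)).1
end

section
/- Assume (A0) and s0 > 0, and let (x1^l, x2^l, x3^l) for 0 ≤ l ≤ L−1 satisfy the Krylov recursion: s0·M1·x1^0 + G·x2^0 = 0, s0·M2·x2^0 − Gᵀ·x1^0 + D·x2^0 + Nᵀ·x3^0 = b, N·x2^0 = 0, and for 1 ≤ l ≤ L−1: s0·M1·x1^l + G·x2^l = M1·x1^{l−1}, s0·M2·x2^l − Gᵀ·x1^l + D·x2^l + Nᵀ·x3^l = M2·x2^{l−1}, N·x2^l = 0. Let o1 ∈ ℝ^{k1} and let o2 ∈ ℝ^{k2} satisfy G·o2 = M1·o1 and N·o2 = 0. Define the subspaces 𝕍1 = span{x1^0, …, x1^{L−1}, o1} ⊆ ℝ^{k1} and 𝕍2 = span{x2^0, …, x2^{L−1}, o2} + ker(G) ⊆ ℝ^{k2}. Then o1 ∈ 𝕍1, ker(G) ⊆ 𝕍2, the image of the kernel of G under N is all of ℝ^{k3}, and the image of 𝕍1 under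 the linear map x ↦ M1·x equals the image of 𝕍2 under the linear map x ↦ G·x. (Hence any injective matrices V1, V2 whose column spaces are 𝕍1 and 𝕍2 satisfy the compatibility conditions (A1)–(A3).) -/
open Matrix

/-- If the transpose `(x, y) ↦ Gᵀ x + Nᵀ y` of a stacked matrix is injective, then
the stacked map `v ↦ (G v, N v)` is surjective. -/
theorem exists_mulVec_eq_and_mulVec_eq {k m n : Type*} [Fintype k] [Fintype m] [Fintype n]
    (G : Matrix m n ℝ) (N : Matrix k n ℝ)
    (hGN : Function.Injective fun x : (m → ℝ) × (k → ℝ) => Gᵀ.mulVec x.1 + Nᵀ.mulVec x.2)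
    (y : m → ℝ) (z : k → ℝ) : ∃ v, G.mulVec v = y ∧ N.mulVec v = z := by
  let T : (m → ℝ) × (k → ℝ) →ₗ[ℝ] (n → ℝ) := Gᵀ.mulVecLin.coprod Nᵀ.mulVecLin
  let S : (m → ℝ) × (k → ℝ) →ₗ[ℝ] (m → ℝ) × (k → ℝ) :=
    (G.mulVecLin.prod N.mulVecLin) ∘ₗ T
  have hS : Function.Injective S := by
    rw [injective_iff_map_eq_zero]
    intro x hx
    have hG : G.mulVec (T x) = 0 := congrArg Prod.fst hx
    have hN : N.mulVec (T x) = 0 := congrArg Prod.snd hx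
    have hT : T x = 0 := by
      have h : T x ⬝ᵥ T x = 0 := by
        calc T x ⬝ᵥ T x = (Gᵀ.mulVec x.1 + Nᵀ.mulVec x.2) ⬝ᵥ T x := rfl
          _ = 0 := by
            rw [add_dotProduct, mulVec_transpose, mulVec_transpose, ← dotProduct_mulVec,
              ← dotProduct_mulVec, hG, hN, dotProduct_zero, dotProduct_zero, add_zero]
      exact dotProduct_self_eq_zero.mp h
    refine hGN ?_
    change T x = T 0
    rw [hT, map_zero]
  obtain ⟨x, hx⟩ := LinearMap.injective_iff_surjective.mp hS (y, z)
  exact ⟨T x, congrArg Prod.fst hx, congrArg Prod.snd hx⟩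

/-- If `f` and `g` satisfy `s • f (x l) + g (y l) = f (x (l - 1))` for `1 ≤ l < L`, with
zero right-hand side at `l = 0`, and `g p = f o`, then `f` and `g` have equal images on
the spans of the respective sequences, enriched by `o` and `p`. -/
theorem map_span_eq_map_span_of_recursion {K E F H : Type*} [Field K] [AddCommGroup E]
    [Module K E] [AddCommGroup F] [Module K F] [AddCommGroup H] [Module K H]
    (f : E →ₗ[K] H) (g : F →ₗ[K] H) {s : K} (hs : s ≠ 0) (L : ℕ) (x : ℕ → E) (y : ℕ → F)
    (h0 : s • f (x 0) + g (y 0) = 0)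
    (hrec : ∀ l, 1 ≤ l → l ≤ L - 1 → s • f (x l) + g (y l) = f (x (l - 1)))
    {o : E} {p : F} (ho : g p = f o) :
    Submodule.map f (Submodule.span K (x '' Set.Iio L ∪ {o})) =
      Submodule.map g (Submodule.span K (y '' Set.Iio L ∪ {p})) := by
  apply le_antisymm
  · have hy : ∀ l < L, g (y l) ∈ Submodule.map g (Submodule.span K (y '' Set.Iio L ∪ {p})) :=
      fun l hl => Submodule.mem_map_of_mem (Submodule.subset_span (Or.inl ⟨l, hl, rfl⟩))
    rw [Submodule.map_span_le]
    rintro _ (⟨l, hl, rfl⟩ | rfl)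
    · induction l with
      | zero =>
        rw [← Submodule.smul_mem_iff _ hs, eq_neg_of_add_eq_zero_left h0]
        exact neg_mem (hy 0 hl)
      | succ l ih =>
        have hl' : l + 1 < L := hl
        rw [← Submodule.smul_mem_iff _ hs,
          eq_sub_of_add_eq (hrec (l + 1) (by omega) (by omega))]
        exact sub_mem (ih (Nat.lt_of_succ_lt hl')) (hy _ hl')
    · rw [← ho]
      exact Submodule.mem_map_of_mem (Submodule.subset_span (Or.inr rfl))
  · have hx : ∀ l < L, f (x l) ∈ Submodule.map f (Submodule.span K (x '' Set.Iio L ∪ {o})) :=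
      fun l hl => Submodule.mem_map_of_mem (Submodule.subset_span (Or.inl ⟨l, hl, rfl⟩))
    rw [Submodule.map_span_le]
    rintro _ (⟨l, hl, rfl⟩ | rfl)
    · have hl' : l < L := hl
      rcases l with _ | l
      · rw [eq_neg_of_add_eq_zero_right h0]
        exact neg_mem (Submodule.smul_mem _ _ (hx 0 hl'))
      · rw [eq_sub_of_add_eq' (hrec (l + 1) (by omega) (by omega))]
        exact sub_mem (hx l (Nat.lt_of_succ_lt hl')) (Submodule.smul_mem _ _ (hx _ hl'))
    · rw [ho]
      exact Submodule.mem_map_of_mem (Submodule.subset_span (Or.inr rfl))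

/-- Under (A0) and s0 > 0, the enriched subspaces 𝕍1 = span{x1⁰,…,x1^{L-1}, o1}
and 𝕍2 = span{x2⁰,…,x2^{L-1}, o2} + ker G satisfy the compatibility conditions
(A1)–(A3): o1 ∈ 𝕍1, ker G ⊆ 𝕍2, N(ker G) = ℝ^{k3}, and M1·𝕍1 = G·𝕍2. -/
theorem modified_subspaces_satisfy_compatibility {k1 k2 k3 : ℕ}
    (M1 : Matrix (Fin k1) (Fin k1) ℝ) (M2 D : Matrix (Fin k2) (Fin k2) ℝ)
    (G : Matrix (Fin k1) (Fin k2) ℝ) (N : Matrix (Fin k3) (Fin k2) ℝ)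
    (hM1 : M1.PosDef) (hM2 : M2.PosDef) (hD : D.PosDef)
    (hGN : Function.Injective fun x : (Fin k1 → ℝ) × (Fin k3 → ℝ) =>
      Gᵀ.mulVec x.1 + Nᵀ.mulVec x.2)
    (L : ℕ) (hL : 1 ≤ L) (b : Fin k2 → ℝ)
    (s0 : ℝ) (hs0 : 0 < s0)
    (x1 : ℕ → Fin k1 → ℝ) (x2 : ℕ → Fin k2 → ℝ) (x3 : ℕ → Fin k3 → ℝ)
    (h0 : s0 • M1.mulVec (x1 0) + G.mulVec (x2 0) = 0 ∧
      s0 • M2.mulVec (x2 0) - Gᵀ.mulVec (x1 0) + D.mulVec (x2 0) + Nᵀ.mulVec (x3 0) = b ∧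
      N.mulVec (x2 0) = 0)
    (hrec : ∀ l : ℕ, 1 ≤ l → l ≤ L - 1 →
      s0 • M1.mulVec (x1 l) + G.mulVec (x2 l) = M1.mulVec (x1 (l - 1)) ∧
      s0 • M2.mulVec (x2 l) - Gᵀ.mulVec (x1 l) + D.mulVec (x2 l) + Nᵀ.mulVec (x3 l) =
        M2.mulVec (x2 (l - 1)) ∧
      N.mulVec (x2 l) = 0)
    (o1 : Fin k1 → ℝ) (o2 : Fin k2 → ℝ)
    (ho2 : G.mulVec o2 = M1.mulVec o1 ∧ N.mulVec o2 = 0) :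
    o1 ∈ Submodule.span ℝ (x1 '' Set.Iio L ∪ {o1}) ∧
    LinearMap.ker G.mulVecLin ≤
      Submodule.span ℝ (x2 '' Set.Iio L ∪ {o2}) ⊔ LinearMap.ker G.mulVecLin ∧
    Submodule.map N.mulVecLin (LinearMap.ker G.mulVecLin) = ⊤ ∧
    Submodule.map M1.mulVecLin (Submodule.span ℝ (x1 '' Set.Iio L ∪ {o1})) =
      Submodule.map G.mulVecLin
        (Submodule.span ℝ (x2 '' Set.Iio L ∪ {o2}) ⊔ LinearMap.ker G.mulVecLin) := by
  refine ⟨Submodule.subset_span (Or.inr rfl), le_sup_right, ?_, ?_⟩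
  · refine eq_top_iff.mpr fun z _ => ?_
    obtain ⟨v, hG, hN⟩ := exists_mulVec_eq_and_mulVec_eq G N hGN 0 z
    exact ⟨v, hG, hN⟩
  · rw [Submodule.map_sup, LinearMap.le_ker_iff_map.mp le_rfl, sup_bot_eq]
    exact map_span_eq_map_span_of_recursion M1.mulVecLin G.mulVecLin hs0.ne' L x1 x2 h0.1
      (fun l h1 h2 => (hrec l h1 h2).1) ho2.1
end

section
/- (Passivity and energy dissipation.) Assume M1 and M2 are symmetric and D is positive semidefinite. Let u, x1, x2, x3 satisfy for all t: M1·x1'(t) + G·x2(t) = 0, M2·x2'(t) − Gᵀ·x1(t) + D·x2(t) − Nᵀ·x3(t) = B2·u(t), N·x2(t) = 0, with x1, x2 differentiable. Then for every t the derivative of the energy E_h(t) = (1/2)·(⟨x1(t), M1·x1(t)⟩ + ⟨x2(t), M2·x2(t)⟩) satisfies E_h'(t) ≤ ⟨B2ᵀ·x2(t), u(t)⟩. In particular, if u ≡ 0 then E_h is monotone nonincreasing on ℝ. -/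
open Matrix

theorem transpose_mulVec_dotProduct {m n R : Type*} [Fintype m] [Fintype n] [CommSemiring R]
    (A : Matrix m n R) (x : m → R) (y : n → R) : Aᵀ *ᵥ x ⬝ᵥ y = x ⬝ᵥ A *ᵥ y := by
  rw [mulVec_transpose, dotProduct_mulVec]

theorem HasDerivAt.dotProduct {n : Type*} [Fintype n] {x y : ℝ → n → ℝ} {x' y' : n → ℝ} {t : ℝ}
    (hx : HasDerivAt x x' t) (hy : HasDerivAt y y' t) :
    HasDerivAt (fun s => x s ⬝ᵥ y s) (x' ⬝ᵥ y t + x t ⬝ᵥ y') t := by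
  simp only [_root_.dotProduct, ← Finset.sum_add_distrib]
  exact HasDerivAt.fun_sum fun i _ => (hasDerivAt_pi.1 hx i).mul (hasDerivAt_pi.1 hy i)

theorem HasDerivAt.matrix_mulVec {m n : Type*} [Fintype m] [Fintype n] (A : Matrix m n ℝ)
    {x : ℝ → n → ℝ} {x' : n → ℝ} {t : ℝ} (hx : HasDerivAt x x' t) :
    HasDerivAt (fun s => A *ᵥ x s) (A *ᵥ x') t :=
  hasDerivAt_pi.2 fun i => by
    simpa [Matrix.mulVec] using (hasDerivAt_const t (A i)).dotProduct hx

theorem HasDerivAt.dotProduct_mulVec_self {n : Type*} [Fintype n] {M : Matrix n n ℝ}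
    (hM : M.IsSymm) {x : ℝ → n → ℝ} {x' : n → ℝ} {t : ℝ} (hx : HasDerivAt x x' t) :
    HasDerivAt (fun s => x s ⬝ᵥ M *ᵥ x s) (2 * (x t ⬝ᵥ M *ᵥ x')) t := by
  convert hx.dotProduct (hx.matrix_mulVec M) using 1
  rw [← transpose_mulVec_dotProduct, hM.eq, dotProduct_comm x', two_mul]

/-- Passivity and energy dissipation: the derivative of the energy is bounded by
the supplied power, E_h'(t) ≤ ⟨B2ᵀ·x2(t), u(t)⟩; in particular for u ≡ 0 the
energy is monotone nonincreasing. -/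
theorem passivity_energy_dissipation {k1 k2 k3 m : ℕ}
    (M1 : Matrix (Fin k1) (Fin k1) ℝ) (M2 D : Matrix (Fin k2) (Fin k2) ℝ)
    (G : Matrix (Fin k1) (Fin k2) ℝ) (N : Matrix (Fin k3) (Fin k2) ℝ)
    (B2 : Matrix (Fin k2) (Fin m) ℝ)
    (hM1 : M1.IsSymm) (hM2 : M2.IsSymm) (hD : D.PosSemidef)
    (u : ℝ → Fin m → ℝ)
    (x1 : ℝ → Fin k1 → ℝ) (x2 : ℝ → Fin k2 → ℝ) (x3 : ℝ → Fin k3 → ℝ)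
    (x1' : ℝ → Fin k1 → ℝ) (x2' : ℝ → Fin k2 → ℝ)
    (hx1 : ∀ t, HasDerivAt x1 (x1' t) t) (hx2 : ∀ t, HasDerivAt x2 (x2' t) t)
    (heq1 : ∀ t, M1.mulVec (x1' t) + G.mulVec (x2 t) = 0)
    (heq2 : ∀ t, M2.mulVec (x2' t) - Gᵀ.mulVec (x1 t) + D.mulVec (x2 t) -
      Nᵀ.mulVec (x3 t) = B2.mulVec (u t))
    (heq3 : ∀ t, N.mulVec (x2 t) = 0) :
    (∀ t, deriv
        (fun s => (1 / 2) * (x1 s ⬝ᵥ M1.mulVec (x1 s) + x2 s ⬝ᵥ M2.mulVec (x2 s))) t ≤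
      B2ᵀ.mulVec (x2 t) ⬝ᵥ u t) ∧
    ((∀ t, u t = 0) →
      Antitone fun s => (1 / 2) * (x1 s ⬝ᵥ M1.mulVec (x1 s) + x2 s ⬝ᵥ M2.mulVec (x2 s))) := by
  have key (t : ℝ) : HasDerivAt
      (fun s => (1 / 2) * (x1 s ⬝ᵥ M1.mulVec (x1 s) + x2 s ⬝ᵥ M2.mulVec (x2 s)))
      (B2ᵀ.mulVec (x2 t) ⬝ᵥ u t - x2 t ⬝ᵥ D *ᵥ x2 t) t := by
    refine ((((hx1 t).dotProduct_mulVec_self hM1).add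
      ((hx2 t).dotProduct_mulVec_self hM2)).const_mul (1 / 2 : ℝ)).congr_deriv ?_
    have h1 := congrArg (x1 t ⬝ᵥ ·) (heq1 t)
    have h2 := congrArg (x2 t ⬝ᵥ ·) (heq2 t)
    have hG : x2 t ⬝ᵥ Gᵀ *ᵥ x1 t = x1 t ⬝ᵥ G *ᵥ x2 t := by
      rw [dotProduct_comm, transpose_mulVec_dotProduct]
    have hN : x2 t ⬝ᵥ Nᵀ *ᵥ x3 t = 0 := by
      rw [dotProduct_comm, transpose_mulVec_dotProduct, heq3, dotProduct_zero]
    simp only [dotProduct_add, dotProduct_sub, dotProduct_zero, hG, hN] at h1 h2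
    rw [transpose_mulVec_dotProduct]
    linarith
  have hD0 (t : ℝ) : 0 ≤ x2 t ⬝ᵥ D *ᵥ x2 t := by
    simpa using hD.dotProduct_mulVec_nonneg (x2 t)
  have bound (t : ℝ) : deriv
      (fun s => (1 / 2) * (x1 s ⬝ᵥ M1.mulVec (x1 s) + x2 s ⬝ᵥ M2.mulVec (x2 s))) t ≤
      B2ᵀ.mulVec (x2 t) ⬝ᵥ u t := by
    rw [(key t).deriv]
    linarith [hD0 t]
  refine ⟨bound, fun hu => antitone_of_deriv_nonpos (fun t => (key t).differentiableAt) fun t => ?_⟩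
  simpa [hu] using bound t
end

section
/- (Algebraic mass conservation.) Let x1 : ℝ → ℝ^{k1} be differentiable and x2 : ℝ → ℝ^{k2} be such that M1·x1'(t) + G·x2(t) = 0 for all t. Let o1 ∈ ℝ^{k1} and ô ∈ ℝ^{m} satisfy Gᵀ·o1 = B2·ô. Then the total mass m_h(t) = ⟨o1, M1·x1(t)⟩ is differentiable with derivative m_h'(t) = −⟨ô, B2ᵀ·x2(t)⟩ = −⟨ô, y(t)⟩ for all t, where y(t) = B2ᵀ·x2(t) is the output. -/
open Matrix

/-- Algebraic mass conservation: with Gᵀ·o1 = B2·ô, the total mass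
m_h(t) = ⟨o1, M1·x1(t)⟩ satisfies m_h'(t) = −⟨ô, y(t)⟩ with output y = B2ᵀ·x2. -/
theorem algebraic_mass_conservation {k1 k2 m : ℕ}
    (M1 : Matrix (Fin k1) (Fin k1) ℝ) (hM1 : M1.IsSymm)
    (G : Matrix (Fin k1) (Fin k2) ℝ) (B2 : Matrix (Fin k2) (Fin m) ℝ)
    (x1 : ℝ → Fin k1 → ℝ) (x2 : ℝ → Fin k2 → ℝ)
    (x1' : ℝ → Fin k1 → ℝ)
    (hx1 : ∀ t, HasDerivAt x1 (x1' t) t)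
    (heq1 : ∀ t, M1.mulVec (x1' t) + G.mulVec (x2 t) = 0)
    (o1 : Fin k1 → ℝ) (ohat : Fin m → ℝ)
    (ho : Gᵀ.mulVec o1 = B2.mulVec ohat) :
    ∀ t, HasDerivAt (fun s => o1 ⬝ᵥ M1.mulVec (x1 s))
      (-(ohat ⬝ᵥ B2ᵀ.mulVec (x2 t))) t := by
  intro t
  have hderiv : HasDerivAt (fun s => o1 ⬝ᵥ M1.mulVec (x1 s)) (o1 ⬝ᵥ M1.mulVec (x1' t)) t := by
    simp only [dotProduct, mulVec]
    exact HasDerivAt.fun_sum fun i _ => (HasDerivAt.fun_sum fun j _ =>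
      ((hasDerivAt_pi.1 (hx1 t) j).const_mul (M1 i j))).const_mul (o1 i)
  have hvalue : o1 ⬝ᵥ M1.mulVec (x1' t) = -(ohat ⬝ᵥ B2ᵀ.mulVec (x2 t)) := by
    rw [eq_neg_of_add_eq_zero_left (heq1 t), dotProduct_neg, dotProduct_mulVec,
      ← mulVec_transpose, ho, dotProduct_mulVec, vecMul_transpose]
  exact hvalue ▸ hderiv
end
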